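/- Let d > 0, let F0 ∈ ℝ³ be a unit vector, set D := dF0, and fix t0 ∈ ℝ. A C³ curve Y : ℝ → ℝ³ satisfies Y'''(t) + D × Y''(t) = 0 for all t ∈ ℝ if and only if there exist c₀, c₁, c₂ ∈ ℝ and vectors A₀, A₁, B ∈ ℝ³ each orthogonal to F0 such that for all t: Y(t) = (c₀ + c₁(t−t0) + c₂(t−t0)²)·F0 + A₀ + (t−t0)·A₁ + cos(d(t−t0))·B − sin(d(t−t0))·(F0 × B). -/

import Mathlib

noncomputable section
open scoped RealInnerProductSpace

/-- `ℝ³` with the Euclidean inner product. -/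
abbrev E3 : Type := EuclideanSpace ℝ (Fin 3)

/-- The cross product on `ℝ³`; with `⁅u,v⁆ := cross u v`, `ℝ³` is the Lie algebra `so(3)`. -/
def cross (u v : E3) : E3 :=
  (WithLp.equiv 2 (Fin 3 → ℝ)).symm
    ![u 1 * v 2 - u 2 * v 1, u 2 * v 0 - u 0 * v 2, u 0 * v 1 - u 1 * v 0]

lemma cross_apply0 (u v : E3) : cross u v 0 = u 1 * v 2 - u 2 * v 1 := rfl
lemma cross_apply1 (u v : E3) : cross u v 1 = u 2 * v 0 - u 0 * v 2 := rfl
lemma cross_apply2 (u v : E3) : cross u v 2 = u 0 * v 1 - u 1 * v 0 := rfl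

lemma inner_E3 (u v : E3) : ⟪u, v⟫ = u 0 * v 0 + u 1 * v 1 + u 2 * v 2 := by
  simp [PiLp.inner_apply, Fin.sum_univ_three]; ring

lemma E3_ext {u v : E3} (h0 : u 0 = v 0) (h1 : u 1 = v 1) (h2 : u 2 = v 2) : u = v := by
  ext i; fin_cases i <;> assumption

lemma cross_add_right (u v w : E3) : cross u (v + w) = cross u v + cross u w := by
  apply E3_ext <;> simp [cross_apply0, cross_apply1, cross_apply2] <;> ring

lemma cross_smul_right (u v : E3) (c : ℝ) : cross u (c • v) = c • cross u v := by
  apply E3_ext <;> simp [cross_apply0, cross_apply1, cross_apply2] <;> ring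

lemma cross_sub_right (u v w : E3) : cross u (v - w) = cross u v - cross u w := by
  apply E3_ext <;> simp [cross_apply0, cross_apply1, cross_apply2] <;> ring

lemma cross_smul_left (u v : E3) (c : ℝ) : cross (c • u) v = c • cross u v := by
  apply E3_ext <;> simp [cross_apply0, cross_apply1, cross_apply2] <;> ring

lemma cross_self' (u : E3) : cross u u = 0 := by
  apply E3_ext <;> simp [cross_apply0, cross_apply1, cross_apply2] <;> ring

lemma inner_cross_right (u v : E3) : ⟪v, cross u v⟫ = 0 := by
  rw [inner_E3, cross_apply0, cross_apply1, cross_apply2]; ring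

lemma inner_cross_left (u v : E3) : ⟪cross u v, u⟫ = 0 := by
  rw [inner_E3, cross_apply0, cross_apply1, cross_apply2]; ring

lemma cross_cross_E3 (u v : E3) (hu : ‖u‖ = 1) : cross u (cross u v) = ⟪v, u⟫ • u - v := by
  have h : ⟪u, u⟫ = 1 := by rw [real_inner_self_eq_norm_sq, hu]; norm_num
  rw [inner_E3] at h
  rw [inner_E3]
  apply E3_ext <;> simp [cross_apply0, cross_apply1, cross_apply2]
  · linear_combination (- v 0) * h
  · linear_combination (- v 1) * h
  · linear_combination (- v 2) * h

/-- The family of explicit curves, closed under differentiation. -/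
def G (d t0 : ℝ) (a0 a1 a2 B C : E3) (t : ℝ) : E3 :=
  a0 + (t - t0) • a1 + (t - t0) ^ 2 • a2 + Real.cos (d * (t - t0)) • B
    - Real.sin (d * (t - t0)) • C

lemma G_hasDerivAt (d t0 : ℝ) (a0 a1 a2 B C : E3) (t : ℝ) :
    HasDerivAt (G d t0 a0 a1 a2 B C) (G d t0 a1 ((2 : ℝ) • a2) 0 (-(d • C)) (d • B) t) t := by
  have h1 : HasDerivAt (fun t : ℝ => t - t0) 1 t := (hasDerivAt_id t).sub_const t0
  have h2 : HasDerivAt (fun t : ℝ => d * (t - t0)) (d * 1) t := h1.const_mul d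
  have h := (((h1.smul_const a1).const_add a0).add ((h1.pow 2).smul_const a2)).add
    (h2.cos.smul_const B) |>.sub (h2.sin.smul_const C)
  refine h.congr_deriv ?_
  simp only [G]
  push_cast
  module

lemma G_deriv (d t0 : ℝ) (a0 a1 a2 B C : E3) :
    deriv (G d t0 a0 a1 a2 B C) = G d t0 a1 ((2 : ℝ) • a2) 0 (-(d • C)) (d • B) :=
  funext fun t => (G_hasDerivAt d t0 a0 a1 a2 B C t).deriv

lemma eq_of_hasDerivAt_zero {f : ℝ → E3} (h : ∀ t, HasDerivAt f 0 t) (a b : ℝ) : f a = f b :=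
  is_const_of_deriv_eq_zero (fun t => (h t).differentiableAt) (fun t => (h t).deriv) a b

/-- General solution of the first variational equation `Y''' + D × Y'' = 0` along the
constant Lie quadratic `D = d·F0` (`d > 0`, `F0` a unit vector): a `C³` curve `Y` solves it
iff `Y(t) = (c₀ + c₁(t−t0) + c₂(t−t0)²)F0 + A₀ + (t−t0)A₁ + cos(d(t−t0))B − sin(d(t−t0))(F0 × B)`
with `A₀, A₁, B` orthogonal to `F0`. -/
theorem stmt_11 (d : ℝ) (hd : 0 < d) (F0 : E3) (hF0 : ‖F0‖ = 1) (t0 : ℝ)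
    (Y : ℝ → E3) (hY : ContDiff ℝ 3 Y) :
    (∀ t : ℝ, iteratedDeriv 3 Y t + cross (d • F0) (iteratedDeriv 2 Y t) = 0) ↔
      ∃ c₀ c₁ c₂ : ℝ, ∃ A₀ A₁ B : E3,
        ⟪A₀, F0⟫ = 0 ∧ ⟪A₁, F0⟫ = 0 ∧ ⟪B, F0⟫ = 0 ∧
        ∀ t : ℝ,
          Y t = (c₀ + c₁ * (t - t0) + c₂ * (t - t0) ^ 2) • F0 + A₀ + (t - t0) • A₁ +
              Real.cos (d * (t - t0)) • B - Real.sin (d * (t - t0)) • cross F0 B := by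
  have i2 : iteratedDeriv 2 Y = deriv (deriv Y) := by
    rw [iteratedDeriv_succ, iteratedDeriv_one]
  have i3 : iteratedDeriv 3 Y = deriv (deriv (deriv Y)) := by
    rw [iteratedDeriv_succ, i2]
  have e1 : ∀ t, HasDerivAt Y (deriv Y t) t := fun t =>
    (hY.differentiable (by norm_num) t).hasDerivAt
  have e2 : ∀ t, HasDerivAt (deriv Y) (deriv (deriv Y) t) t := fun t => by
    have := hY.differentiable_iteratedDeriv 1 (by norm_num)
    rw [iteratedDeriv_one] at this
    exact (this t).hasDerivAt
  have e3 : ∀ t, HasDerivAt (deriv (deriv Y)) (deriv (deriv (deriv Y)) t) t := fun t => by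
    have := hY.differentiable_iteratedDeriv 2 (by norm_num)
    rw [i2] at this
    exact (this t).hasDerivAt
  have hFF : ⟪F0, F0⟫ = 1 := by rw [real_inner_self_eq_norm_sq, hF0]; norm_num
  rw [i2, i3]
  constructor
  · intro h
    set Z0 := deriv (deriv Y) t0 with hZ0
    set c : ℝ := ⟪Z0, F0⟫ / 2 with hc
    set B : E3 := (1 / d ^ 2) • cross F0 (cross F0 Z0) with hB
    have hBF : ⟪B, F0⟫ = 0 := by
      rw [hB, real_inner_smul_left, inner_cross_left, mul_zero]
    have hdB : d ^ 2 • B = ⟪Z0, F0⟫ • F0 - Z0 := by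
      rw [hB, smul_smul, cross_cross_E3 _ _ hF0, mul_one_div_cancel (by positivity), one_smul]
    have hJJB : cross F0 (cross F0 B) = - B := by
      rw [cross_cross_E3 _ _ hF0, hBF]; simp
    have g1 := G_hasDerivAt d t0 0 0 (c • F0) B (cross F0 B)
    set G1 := G d t0 0 ((2 : ℝ) • c • F0) 0 (-(d • cross F0 B)) (d • B) with hG1
    have g2 := G_hasDerivAt d t0 0 ((2 : ℝ) • c • F0) 0 (-(d • cross F0 B)) (d • B)
    rw [← hG1] at g2
    set G2 := G d t0 ((2 : ℝ) • c • F0) ((2 : ℝ) • (0 : E3)) 0 (-(d • d • B))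
      (d • -(d • cross F0 B)) with hG2
    have g3 := G_hasDerivAt d t0 ((2 : ℝ) • c • F0) ((2 : ℝ) • (0 : E3)) 0 (-(d • d • B))
      (d • -(d • cross F0 B))
    rw [← hG2] at g3
    have hH : ∀ t, HasDerivAt (fun t => deriv (deriv Y) t - G2 t)
        (-(d • cross F0 (deriv (deriv Y) t - G2 t))) t := by
      intro t
      refine ((e3 t).sub (g3 t)).congr_deriv ?_
      have := h t
      rw [cross_smul_left] at this
      rw [eq_neg_of_add_eq_zero_left this, cross_sub_right]
      have : cross F0 (G2 t) = (d ^ 2 * -Real.cos (d * (t - t0))) • cross F0 B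
          - (d ^ 2 * Real.sin (d * (t - t0))) • B := by
        have : G2 t = (2 * c) • F0 + (d ^ 2 * -Real.cos (d * (t - t0))) • B
          + (d ^ 2 * Real.sin (d * (t - t0))) • cross F0 B := by
          simp only [hG2, G]; module
        rw [this]
        simp only [cross_add_right, cross_smul_right, cross_self', hJJB]
        module
      rw [this]
      simp only [G]
      module
    have hHz : ∀ t, deriv (deriv Y) t - G2 t = 0 := by
      intro t
      have hn : ∀ t, HasDerivAt (fun t => ‖deriv (deriv Y) t - G2 t‖ ^ 2) 0 t := by
        intro t
        refine (hH t).norm_sq.congr_deriv ?_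
        rw [inner_neg_right, real_inner_smul_right, inner_cross_right]; simp
      have h0 : deriv (deriv Y) t0 - G2 t0 = 0 := by
        have : G2 t0 = (2 * c) • F0 - d ^ 2 • B := by
          simp only [hG2, G, sub_self, mul_zero, Real.cos_zero, Real.sin_zero]; module
        rw [this, hdB, ← hZ0, hc]; module
      have := is_const_of_deriv_eq_zero (fun t => (hn t).differentiableAt)
        (fun t => (hn t).deriv) t t0
      simp only [h0] at this
      simpa using this
    have hV : ∀ t, deriv Y t - G1 t = deriv Y t0 - G1 t0 := fun t =>
      eq_of_hasDerivAt_zero (f := fun t => deriv Y t - G1 t)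
        (fun t => ((e2 t).sub (g2 t)).congr_deriv (hHz t)) t t0
    set V := deriv Y t0 - G1 t0 with hVdef
    have hU : ∀ t, Y t - G d t0 0 0 (c • F0) B (cross F0 B) t - (t - t0) • V
        = Y t0 - G d t0 0 0 (c • F0) B (cross F0 B) t0 - (t0 - t0) • V := fun t =>
      eq_of_hasDerivAt_zero
        (f := fun t => Y t - G d t0 0 0 (c • F0) B (cross F0 B) t - (t - t0) • V)
        (fun t => (((e1 t).sub (g1 t)).sub
          (((hasDerivAt_id t).sub_const t0).smul_const V)).congr_deriv
            (by rw [one_smul, hV t, sub_self])) t t0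
    set U := Y t0 - G d t0 0 0 (c • F0) B (cross F0 B) t0 - (t0 - t0) • V with hUdef
    have horth : ∀ W : E3, ⟪W - ⟪W, F0⟫ • F0, F0⟫ = 0 := by
      intro W
      rw [inner_sub_left, real_inner_smul_left, hFF]; ring
    refine ⟨⟪U, F0⟫, ⟪V, F0⟫, c, U - ⟪U, F0⟫ • F0, V - ⟪V, F0⟫ • F0, B,
      horth U, horth V, hBF, fun t => ?_⟩
    have := hU t
    have hy : Y t = U + G d t0 0 0 (c • F0) B (cross F0 B) t + (t - t0) • V := by
      rw [← this]; abel
    rw [hy]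
    generalize U = U'
    generalize V = V'
    simp only [G]
    module
  · rintro ⟨c₀, c₁, c₂, A₀, A₁, B, -, -, hBF, hYe⟩ t
    have hJJB : cross F0 (cross F0 B) = - B := by
      rw [cross_cross_E3 _ _ hF0, hBF]; simp
    have hYG : Y = G d t0 (c₀ • F0 + A₀) (c₁ • F0 + A₁) (c₂ • F0) B (cross F0 B) := by
      funext t
      rw [hYe t, G]; module
    rw [hYG, G_deriv, G_deriv, G_deriv, cross_smul_left]
    have : ∀ x y : ℝ, cross F0 ((2 * c₂) • F0 + x • B + y • cross F0 B)
        = x • cross F0 B - y • B := by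
      intro x y
      simp only [cross_add_right, cross_smul_right, cross_self', hJJB]
      module
    have h2 : G d t0 ((2 : ℝ) • c₂ • F0) ((2 : ℝ) • (0 : E3)) 0 (-(d • d • B))
        (d • -(d • cross F0 B)) t = (2 * c₂) • F0 + (d ^ 2 * -Real.cos (d * (t - t0))) • B
          + (d ^ 2 * Real.sin (d * (t - t0))) • cross F0 B := by
      simp only [G]; module
    rw [h2, this]
    simp only [G]
    module
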